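/- Let G and G' be canonical weighted voting games on n players such that G is covered by G' in (G_cwvg(n), ⪯_MWC), i.e., the set W_min,G' of minimal winning coalitions of G' equals W_min,G ∪ {C'} for some coalition C' ∉ W_min,G. Then there exist a ceiling C of G and an integer i with 0 ≤ i ≤ |C| such that W_min,G' = W_min,G ∪ {rtrunc(C, i)}. -/

import Mathlib

/-- Player `i` is at least as desirable as player `j` in the simple game `v`. -/
def Desir {n : ℕ} (v : Finset (Fin n) → Prop) (i j : Fin n) : Prop :=
  ∀ S : Finset (Fin n), i ∉ S → j ∉ S → v (insert j S) → v (insert i S)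

/-- `v` is a weighted voting game on `n` players. -/
def IsWVGv (n : ℕ) (v : Finset (Fin n) → Prop) : Prop :=
  ∃ q : ℝ, ∃ w : Fin n → ℝ, 0 ≤ q ∧ (∀ i, 0 ≤ w i) ∧
    ∀ S : Finset (Fin n), v S ↔ q ≤ ∑ i ∈ S, w i

/-- `v` is a canonical weighted voting game. -/
def IsCWVGv (n : ℕ) (v : Finset (Fin n) → Prop) : Prop :=
  IsWVGv n v ∧ ∀ i j : Fin n, i ≤ j → Desir v i j

/-- `S` is a minimal winning coalition of `v`. -/
def IsMWCv (n : ℕ) (v : Finset (Fin n) → Prop) (S : Finset (Fin n)) : Prop :=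
  v S ∧ ∀ p ∈ S, ¬ v (S.erase p)

/-- `S` is a maximal losing coalition of `v`. -/
def IsMaxLosingv (n : ℕ) (v : Finset (Fin n) → Prop) (S : Finset (Fin n)) : Prop :=
  ¬ v S ∧ ∀ p : Fin n, p ∉ S → v (insert p S)

/-- `S'` is a direct left-shift of `S`: some player `p ∈ S` is replaced by the
player `q = p − 1 ∉ S`. -/
def DLSf {n : ℕ} (S S' : Finset (Fin n)) : Prop :=
  ∃ p q : Fin n, (q : ℕ) + 1 = (p : ℕ) ∧ p ∈ S ∧ q ∉ S ∧ S' = insert q (S.erase p)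

/-- `S'` is a left-shift of `S` (a possibly empty sequence of direct
left-shifts). -/
def LeftShiftF {n : ℕ} : Finset (Fin n) → Finset (Fin n) → Prop :=
  Relation.ReflTransGen DLSf

/-- `S` is a ceiling of `v`: a maximal losing coalition all of whose left-shifts
other than itself are winning. -/
def IsCeilingF (n : ℕ) (v : Finset (Fin n) → Prop) (S : Finset (Fin n)) : Prop :=
  IsMaxLosingv n v S ∧ ∀ S', LeftShiftF S S' → S' ≠ S → v S'

/-- The `i`-th right-truncation of `S`: remove the `i` highest-numbered players
of `S`, i.e. keep the players having at least `i` larger players in `S`. -/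
def rtrunc {n : ℕ} (S : Finset (Fin n)) (i : ℕ) : Finset (Fin n) :=
  S.filter fun p => i ≤ (S.filter fun q => p < q).card

theorem wvg_mono {n : ℕ} {v : Finset (Fin n) → Prop} (h : IsWVGv n v)
    {S T : Finset (Fin n)} (hST : S ⊆ T) (hS : v S) : v T := by
  obtain ⟨q, w, _, hw, hv⟩ := h
  rw [hv] at *
  exact hS.trans (Finset.sum_le_sum_of_subset_of_nonneg hST fun i _ _ => hw i)

theorem exists_mwc {n : ℕ} {v : Finset (Fin n) → Prop} (S : Finset (Fin n)) (hS : v S) :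
    ∃ M ⊆ S, IsMWCv n v M := by
  induction S using Finset.strongInduction with
  | H S ih =>
    by_cases h : ∀ p ∈ S, ¬ v (S.erase p)
    · exact ⟨S, subset_rfl, hS, h⟩
    · push Not at h
      obtain ⟨p, hp, hvp⟩ := h
      obtain ⟨M, hM, hM'⟩ := ih _ (Finset.erase_ssubset hp) hvp
      exact ⟨M, hM.trans (Finset.erase_subset _ _), hM'⟩

theorem dls_win {n : ℕ} {v : Finset (Fin n) → Prop} (h : IsCWVGv n v)
    {S T : Finset (Fin n)} (hST : DLSf S T) (hS : v S) : v T := by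
  obtain ⟨p, q, hpq, hp, hq, rfl⟩ := hST
  refine h.2 q p (by rw [Fin.le_def]; omega) (S.erase p) (fun h => hq (Finset.mem_of_mem_erase h))
    (Finset.notMem_erase _ _) ?_
  rwa [Finset.insert_erase hp]

theorem left_win {n : ℕ} {v : Finset (Fin n) → Prop} (h : IsCWVGv n v)
    {S T : Finset (Fin n)} (hST : LeftShiftF S T) (hS : v S) : v T := by
  induction hST with
  | refl => exact hS
  | tail _ h2 ih => exact dls_win h h2 ih

/-- If the canonical weighted voting game `G'` covers `G`, i.e.
the MWC set of `G'` is that of `G` plus one new coalition, then there are a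
ceiling `C` of `G` and `0 ≤ i ≤ |C|` with
`W_min(G') = W_min(G) ∪ {rtrunc(C,i)}`. -/
theorem stmt18 (n : ℕ) (v v' : Finset (Fin n) → Prop)
    (hv : IsCWVGv n v) (hv' : IsCWVGv n v')
    (hcov : ∃ C' : Finset (Fin n), C' ∉ {S | IsMWCv n v S} ∧
      {S | IsMWCv n v' S} = {S | IsMWCv n v S} ∪ {C'}) :
    ∃ C : Finset (Fin n), IsCeilingF n v C ∧ ∃ i : ℕ, i ≤ C.card ∧
      {S | IsMWCv n v' S} = {S | IsMWCv n v S} ∪ {rtrunc C i} := by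
  obtain ⟨C', hC', hW⟩ := hcov
  simp only [Set.mem_ofPred_eq] at hC'
  have hmem : ∀ S, IsMWCv n v' S ↔ IsMWCv n v S ∨ S = C' := by
    intro S
    have := Set.ext_iff.1 hW S
    simpa [or_comm] using this
  have hC'm : IsMWCv n v' C' := (hmem C').2 (Or.inr rfl)
  have hlose : ¬ v C' := by
    intro hvC
    obtain ⟨M, hMC, hM⟩ := exists_mwc C' hvC
    have hne : M ≠ C' := by rintro rfl; exact hC' hM
    obtain ⟨a, ha, haM⟩ := Finset.exists_of_ssubset (hMC.ssubset_of_ne hne)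
    exact hC'm.2 a ha (wvg_mono hv'.1 (Finset.subset_erase.2 ⟨hMC, haM⟩)
      ((hmem M).2 (Or.inl hM)).1)
  have hstep : ∀ S, v' S → ¬ C' ⊆ S → v S := by
    intro S hS hCS
    obtain ⟨M, hMS, hM⟩ := exists_mwc S hS
    rcases (hmem M).1 hM with h | rfl
    · exact wvg_mono hv.1 hMS h.1
    · exact absurd hMS hCS
  have hshift : ∀ a ∈ C', ∀ j, j ∉ C' → j < a → v (insert j (C'.erase a)) := by
    intro a ha j hj hja
    apply hstep
    · refine hv'.2 j a hja.le (C'.erase a) (fun h => hj (Finset.mem_of_mem_erase h))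
        (Finset.notMem_erase _ _) ?_
      rw [Finset.insert_erase ha]
      exact hC'm.1
    · intro h
      have := h ha
      simp only [Finset.mem_insert, Finset.mem_erase] at this
      rcases this with h | h
      · exact hja.ne' h
      · exact h.1 rfl
  classical
  let f : Finset (Fin n) → ℕ := fun T => ∑ i ∈ T, (n - (i : ℕ))
  obtain ⟨T, hT, hTmax⟩ := Finset.exists_max_image
    (Finset.univ.filter fun T : Finset (Fin n) => C' ⊆ T ∧ ¬ v T) f ⟨C', by simp [hlose]⟩
  simp only [Finset.mem_filter, Finset.mem_univ, true_and] at hT hTmax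
  obtain ⟨hCT, hTl⟩ := hT
  have hwin : ∀ U, C' ⊆ U → f T < f U → v U := by
    intro U hU hf
    by_contra h
    exact absurd (hTmax U ⟨hU, h⟩) (not_le.2 hf)
  have hord : ∀ j ∈ T, j ∉ C' → ∀ a ∈ C', a < j := by
    intro j hj hjC a ha
    by_contra h
    have hja : j < a := lt_of_le_of_ne (not_lt.1 h) (by rintro rfl; exact hjC ha)
    refine hTl (wvg_mono hv.1 ?_ (hshift a ha j hjC hja))
    exact Finset.insert_subset hj ((Finset.erase_subset _ _).trans hCT)
  have hceil : IsCeilingF n v T := by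
    refine ⟨⟨hTl, ?_⟩, ?_⟩
    · intro p hp
      apply hwin _ (hCT.trans (Finset.subset_insert _ _))
      have := p.2
      simp only [f, Finset.sum_insert hp]
      omega
    · intro S' hS' hne
      rcases Relation.ReflTransGen.cases_head hS' with h | ⟨U, hU, hUS⟩
      · exact absurd h.symm hne
      · refine left_win hv hUS ?_
        obtain ⟨p, q, hpq, hp, hq, rfl⟩ := hU
        by_cases hpC : p ∈ C'
        · refine wvg_mono hv.1 ?_ (hshift p hpC q (fun h => hq (hCT h))
            (by rw [Fin.lt_def]; omega))
          exact Finset.insert_subset_insert _ (Finset.erase_subset_erase _ hCT)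
        · apply hwin
          · exact (Finset.subset_erase.2 ⟨hCT, hpC⟩).trans (Finset.subset_insert _ _)
          · have h1 := Finset.add_sum_erase T (fun i : Fin n => n - (i : ℕ)) hp
            have hq' : q ∉ T.erase p := fun h => hq (Finset.mem_of_mem_erase h)
            have := p.2
            simp only [f, Finset.sum_insert hq']
            omega
  refine ⟨T, hceil, (T \ C').card, Finset.card_le_card Finset.sdiff_subset, ?_⟩
  have : rtrunc T (T \ C').card = C' := by
    ext p
    simp only [rtrunc, Finset.mem_filter]
    constructor
    · rintro ⟨hp, hc⟩
      by_contra hpC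
      refine absurd hc (not_le.2 (Finset.card_lt_card ?_))
      rw [Finset.ssubset_iff_of_subset]
      · exact ⟨p, by simp [hp, hpC], by simp⟩
      · intro q hq
        simp only [Finset.mem_filter] at hq
        simp only [Finset.mem_sdiff]
        exact ⟨hq.1, fun h => absurd (hord p hp hpC q h) (not_lt.2 hq.2.le)⟩
    · intro hp
      refine ⟨hCT hp, Finset.card_le_card ?_⟩
      intro q hq
      simp only [Finset.mem_sdiff] at hq
      simp only [Finset.mem_filter]
      exact ⟨hq.1, hord q hq.1 hq.2 p hp⟩
  rw [this, hW]
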